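/- arXiv:1605.05898 — 4 statements merged into one kernel-verified Lean document; each statement's English description precedes it below -/
import Mathlib

section
/- Let α ∈ (0,2], let u₁ be S(α,β₁,γ₁,δ₁;0)-distributed and u₂ be S(α,β₂,γ₂,δ₂;0)-distributed with γ₁, γ₂ > 0, and suppose u₁ and u₂ are independent. Then u₁ + u₂ is S(α,β,γ,δ;0)-distributed, where β = (β₁γ₁^α + β₂γ₂^α)/(γ₁^α + γ₂^α), γ = (γ₁^α + γ₂^α)^{1/α}, and δ = δ₁ + δ₂ + tan(πα/2)·(βγ − β₁γ₁ − β₂γ₂) if α ≠ 1, while δ = δ₁ + δ₂ + (2/π)·(βγ·log γ − β₁γ₁·log γ₁ − β₂γ₂·log γ₂) if α = 1. -/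
open MeasureTheory ProbabilityTheory Complex

/-- The characteristic function of the stable distribution `S(α, β, γ, δ; 0)` in
Nolan's "Parametrisation 0". (Note `Real.log 0 = 0` in Mathlib, matching the
convention `0 · log 0 = 0`.) -/
noncomputable def stableCharFun (α β γ δ : ℝ) (t : ℝ) : ℂ :=
  if α = 1 then
    Complex.exp (Complex.I * (δ * t) - (|γ * t| : ℝ) *
      (1 + Complex.I * (β : ℝ) * ((2 / Real.pi : ℝ)) * (Real.sign t : ℝ) *
        (Real.log (γ * |t|) : ℝ)))
  else
    Complex.exp (Complex.I * (δ * t) - ((|γ * t| ^ α : ℝ) : ℂ) *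
      (1 + Complex.I * (β : ℝ) * (Real.tan (Real.pi * α / 2) : ℝ) * (Real.sign t : ℝ) *
        (((|γ * t| ^ (1 - α) : ℝ) : ℂ) - 1)))

/-- A real random variable `u` on `(Ω, P)` is `S(α, β, γ, δ; 0)`-distributed if its
characteristic function `E[exp(itu)]` equals `stableCharFun α β γ δ t` for all `t`. -/
def IsStable0 {Ω : Type*} [MeasurableSpace Ω] (P : Measure Ω) (u : Ω → ℝ)
    (α β γ δ : ℝ) : Prop :=
  ∀ t : ℝ, (∫ ω, Complex.exp (Complex.I * (t : ℝ) * (u ω : ℝ)) ∂P) = stableCharFun α β γ δ t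

/-- If `E[exp(itu)]` is nonzero, then `exp(itu)` is integrable. -/
lemma IsStable0.integrable {Ω : Type*} [MeasurableSpace Ω] {P : Measure Ω} {u : Ω → ℝ}
    {α β γ δ : ℝ} (hu : IsStable0 P u α β γ δ) (t : ℝ) :
    Integrable (fun ω => Complex.exp (Complex.I * (t : ℝ) * (u ω : ℝ))) P := by
  by_contra h
  have ht := hu t
  rw [integral_undef h, stableCharFun] at ht
  split_ifs at ht <;> exact Complex.exp_ne_zero _ ht.symm

lemma abs_mul_realSign (t : ℝ) : |t| * Real.sign t = t := by
  rcases lt_trichotomy t 0 with h | rfl | h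
  · simp [Real.sign_of_neg h, abs_of_neg h]
  · simp
  · simp [Real.sign_of_pos h, abs_of_pos h]

/-- The stable characteristic function of index one, as the exponential of an expression that
is linear in `δ`, `γ`, `β * γ` and `β * γ * log γ`. -/
lemma stableCharFun_one {β γ δ : ℝ} (hγ : 0 < γ) (t : ℝ) :
    stableCharFun 1 β γ δ t = Complex.exp (Complex.I *
      ((δ * t - 2 / Real.pi * (β * γ * Real.log γ * t + β * γ * (t * Real.log |t|)) : ℝ) : ℂ)
        - ((γ * |t| : ℝ) : ℂ)) := by
  rw [stableCharFun, if_pos rfl, abs_mul, abs_of_pos hγ]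
  congr 1
  rcases eq_or_ne t 0 with rfl | ht
  · simp
  · have hs : (t : ℂ) = ((|t| : ℝ) : ℂ) * (Real.sign t : ℝ) := by
      rw [← Complex.ofReal_mul, abs_mul_realSign]
    rw [Real.log_mul hγ.ne' (abs_pos.mpr ht).ne']
    push_cast
    linear_combination (Complex.I * (2 / Real.pi) * β * γ *
      (Real.log γ + Real.log |t|)) * hs

/-- The stable characteristic function of index `α ≠ 1`, as the exponential of an expression
that is linear in `δ`, `γ ^ α`, `β * γ` and `β * γ ^ α`. -/
lemma stableCharFun_of_ne_one {α β γ δ : ℝ} (hα : 0 < α) (hα1 : α ≠ 1) (hγ : 0 < γ) (t : ℝ) :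
    stableCharFun α β γ δ t = Complex.exp (Complex.I *
      ((δ * t - Real.tan (Real.pi * α / 2) *
        (β * γ * t - β * γ ^ α * (|t| ^ α * Real.sign t)) : ℝ) : ℂ)
        - ((γ ^ α * |t| ^ α : ℝ) : ℂ)) := by
  rw [stableCharFun, if_neg hα1, abs_mul, abs_of_pos hγ]
  congr 1
  rcases eq_or_ne t 0 with rfl | ht
  · simp [Real.zero_rpow hα.ne']
  · have hpos : 0 < γ * |t| := mul_pos hγ (abs_pos.mpr ht)
    have hs : (t : ℂ) = ((|t| : ℝ) : ℂ) * (Real.sign t : ℝ) := by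
      rw [← Complex.ofReal_mul, abs_mul_realSign]
    have hp : (((γ * |t|) ^ α : ℝ) : ℂ) * (((γ * |t|) ^ (1 - α) : ℝ) : ℂ)
        = (γ : ℂ) * ((|t| : ℝ) : ℂ) := by
      rw [← Complex.ofReal_mul, ← Real.rpow_add hpos, add_sub_cancel, Real.rpow_one,
        Complex.ofReal_mul]
    have hm : (((γ * |t|) ^ α : ℝ) : ℂ) = ((γ ^ α : ℝ) : ℂ) * ((|t| ^ α : ℝ) : ℂ) := by
      rw [← Complex.ofReal_mul, Real.mul_rpow hγ.le (abs_nonneg t)]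
    simp only [Complex.ofReal_sub, Complex.ofReal_mul]
    linear_combination
      (-Complex.I * β * (Real.tan (Real.pi * α / 2) : ℝ) * (Real.sign t : ℝ)) * hp
      + (-1 + Complex.I * β * (Real.tan (Real.pi * α / 2) : ℝ) * (Real.sign t : ℝ)) * hm
      + (Complex.I * β * (Real.tan (Real.pi * α / 2) : ℝ) * γ) * hs

/-- The expectation of `exp(it(u₁ + u₂))` factors for independent stable variables. -/
lemma IsStable0.integral_exp_add {Ω : Type*} [MeasurableSpace Ω] {P : Measure Ω}
    {u₁ u₂ : Ω → ℝ} {α₁ α₂ β₁ β₂ γ₁ γ₂ δ₁ δ₂ : ℝ}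
    (hu₁ : IsStable0 P u₁ α₁ β₁ γ₁ δ₁) (hu₂ : IsStable0 P u₂ α₂ β₂ γ₂ δ₂)
    (hindep : IndepFun u₁ u₂ P) (t : ℝ) :
    ∫ ω, Complex.exp (Complex.I * (t : ℝ) * ((u₁ ω + u₂ ω : ℝ) : ℂ)) ∂P
      = stableCharFun α₁ β₁ γ₁ δ₁ t * stableCharFun α₂ β₂ γ₂ δ₂ t := by
  have hm : Measurable fun x : ℝ => Complex.exp (Complex.I * (t : ℝ) * (x : ℂ)) := by fun_prop
  rw [← hu₁ t, ← hu₂ t]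
  refine Eq.trans (integral_congr_ae (.of_forall fun ω => ?_))
    ((hindep.comp hm hm).integral_fun_mul_eq_mul_integral
      (hu₁.integrable t).aestronglyMeasurable (hu₂.integrable t).aestronglyMeasurable)
  simp only [Function.comp_apply, Complex.ofReal_add, mul_add, Complex.exp_add]

/-- Sums of independent stable random variables of the same index `α` are stable, with the
stated parameters (Nolan, Proposition 1.16). -/
theorem stable_add_indep
    {Ω : Type*} [MeasurableSpace Ω] (P : Measure Ω) [IsProbabilityMeasure P]
    (u₁ u₂ : Ω → ℝ) (α β₁ β₂ γ₁ γ₂ δ₁ δ₂ : ℝ)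
    (hα : 0 < α) (hα2 : α ≤ 2)
    (hβ₁ : β₁ ∈ Set.Icc (-1 : ℝ) 1) (hβ₂ : β₂ ∈ Set.Icc (-1 : ℝ) 1)
    (hγ₁ : 0 < γ₁) (hγ₂ : 0 < γ₂)
    (hu₁ : IsStable0 P u₁ α β₁ γ₁ δ₁) (hu₂ : IsStable0 P u₂ α β₂ γ₂ δ₂)
    (hindep : IndepFun u₁ u₂ P) :
    IsStable0 P (fun ω => u₁ ω + u₂ ω) α
      ((β₁ * γ₁ ^ α + β₂ * γ₂ ^ α) / (γ₁ ^ α + γ₂ ^ α))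
      ((γ₁ ^ α + γ₂ ^ α) ^ (1 / α))
      (if α = 1 then
        δ₁ + δ₂ + (2 / Real.pi) *
          (((β₁ * γ₁ ^ α + β₂ * γ₂ ^ α) / (γ₁ ^ α + γ₂ ^ α)) * ((γ₁ ^ α + γ₂ ^ α) ^ (1 / α)) *
              Real.log ((γ₁ ^ α + γ₂ ^ α) ^ (1 / α)) -
            β₁ * γ₁ * Real.log γ₁ - β₂ * γ₂ * Real.log γ₂)
      else
        δ₁ + δ₂ + Real.tan (Real.pi * α / 2) *
          (((β₁ * γ₁ ^ α + β₂ * γ₂ ^ α) / (γ₁ ^ α + γ₂ ^ α)) * ((γ₁ ^ α + γ₂ ^ α) ^ (1 / α)) -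
            β₁ * γ₁ - β₂ * γ₂)) := by
  intro t
  rw [hu₁.integral_exp_add hu₂ hindep t]
  have hs : 0 < γ₁ ^ α + γ₂ ^ α := by positivity
  have hγ : 0 < (γ₁ ^ α + γ₂ ^ α) ^ (1 / α) := by positivity
  have hβ : (β₁ * γ₁ ^ α + β₂ * γ₂ ^ α) / (γ₁ ^ α + γ₂ ^ α) * (γ₁ ^ α + γ₂ ^ α)
      = β₁ * γ₁ ^ α + β₂ * γ₂ ^ α := div_mul_cancel₀ _ hs.ne'
  have hγα : ((γ₁ ^ α + γ₂ ^ α) ^ (1 / α)) ^ α = γ₁ ^ α + γ₂ ^ α := by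
    rw [one_div, Real.rpow_inv_rpow hs.le hα.ne']
  generalize (β₁ * γ₁ ^ α + β₂ * γ₂ ^ α) / (γ₁ ^ α + γ₂ ^ α) = β at *
  generalize (γ₁ ^ α + γ₂ ^ α) ^ (1 / α) = γ at *
  rw [← hγα] at hβ
  split_ifs with h1
  · subst h1
    simp only [Real.rpow_one] at hβ hγα
    rw [stableCharFun_one hγ₁, stableCharFun_one hγ₂, stableCharFun_one hγ, ← Complex.exp_add,
      ← add_sub_add_comm, ← mul_add, ← Complex.ofReal_add, ← Complex.ofReal_add]
    congr 4
    · linear_combination (2 / Real.pi * t * Real.log |t|) * hβ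
    · linear_combination -|t| * hγα
  · rw [stableCharFun_of_ne_one hα h1 hγ₁, stableCharFun_of_ne_one hα h1 hγ₂,
      stableCharFun_of_ne_one hα h1 hγ, ← Complex.exp_add,
      ← add_sub_add_comm, ← mul_add, ← Complex.ofReal_add, ← Complex.ofReal_add]
    congr 4
    · linear_combination (-Real.tan (Real.pi * α / 2) * |t| ^ α * Real.sign t) * hβ
    · linear_combination -|t| ^ α * hγα
end

section
/- Let (γ_n)_{n∈ℕ} be strictly positive reals and (h_n)_{n∈ℕ} reals. Let μ = ⨂_{n∈ℕ} C(0,γ_n) and ν = ⨂_{n∈ℕ} C(h_n,γ_n) be the corresponding countable product probability measures on ℝ^ℕ. Then μ and ν are mutually absolutely continuous if and only if ∑_{n∈ℕ} (h_n/γ_n)² < ∞; otherwise they are mutually singular. -/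
open MeasureTheory

/-- The Cauchy distribution `C(δ, γ)` with location `δ` and scale `γ > 0`: the Borel
probability measure on `ℝ` with Lebesgue density `x ↦ (1/(γπ)) (1 + ((x-δ)/γ)²)⁻¹`. -/
noncomputable def cauchyMeasure (δ γ : ℝ) : Measure ℝ :=
  volume.withDensity fun x => ENNReal.ofReal ((γ * Real.pi)⁻¹ * (1 + ((x - δ) / γ) ^ 2)⁻¹)

/-- `μ` is the countable product `⨂ₙ μs n` of probability measures on `ℝ^ℕ` (with the
product σ-algebra), characterised by its values on measurable cylinder sets. -/
def IsProductMeasure (μ : Measure (ℕ → ℝ)) (μs : ℕ → Measure ℝ) : Prop :=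
  ∀ (s : Finset ℕ) (E : ℕ → Set ℝ), (∀ n, MeasurableSet (E n)) →
    μ {x | ∀ n ∈ s, x n ∈ E n} = ∏ n ∈ s, μs n (E n)

open Filter Topology
open scoped ENNReal NNReal symmDiff

section General

variable {Ω : Type*} [MeasurableSpace Ω]

/-- The Cauchy–Schwarz inequality for the Lebesgue integral. -/
lemma sq_lintegral_mul_le (P : Measure Ω) {f g : Ω → ℝ≥0∞} (hf : AEMeasurable f P)
    (hg : AEMeasurable g P) :
    (∫⁻ x, f x * g x ∂P) ^ 2 ≤ (∫⁻ x, f x ^ 2 ∂P) * ∫⁻ x, g x ^ 2 ∂P := by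
  have key := ENNReal.lintegral_mul_le_Lp_mul_Lq P Real.HolderConjugate.two_two hf hg
  simp only [Pi.mul_apply, ENNReal.rpow_two] at key
  have hsq (a : ℝ≥0∞) : (a ^ (1 / 2 : ℝ)) ^ 2 = a := by
    rw [← ENNReal.rpow_natCast, ← ENNReal.rpow_mul]
    norm_num
  calc _ ≤ _ := pow_le_pow_left' key 2
    _ = _ := by rw [mul_pow, hsq, hsq]

lemma sq_withDensity_apply_le (P : Measure Ω) {f : Ω → ℝ≥0∞} (hf : Measurable f) {s : Set Ω}
    (hs : MeasurableSet s) :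
    P.withDensity f s ^ 2 ≤ (∫⁻ x, f x ^ 2 ∂P) * P s := by
  rw [withDensity_apply _ hs]
  calc (∫⁻ x in s, f x ∂P) ^ 2 = (∫⁻ x in s, f x * 1 ∂P) ^ 2 := by simp
    _ ≤ (∫⁻ x in s, f x ^ 2 ∂P) * ∫⁻ x in s, 1 ^ 2 ∂P :=
      sq_lintegral_mul_le _ hf.aemeasurable aemeasurable_const
    _ ≤ (∫⁻ x, f x ^ 2 ∂P) * P s := by
      simp only [one_pow, lintegral_one, Measure.restrict_apply_univ]
      gcongr
      exact Measure.restrict_le_self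

/-- Two measures whose Hellinger affinity is small are almost separated by a measurable set. -/
lemma exists_measure_le_lintegral_withDensity_sq (P : Measure Ω) {g : Ω → ℝ≥0∞}
    (hg : Measurable g) :
    ∃ s, MeasurableSet s ∧ P s ≤ ∫⁻ x, g x ∂P ∧
      P.withDensity (fun x => g x ^ 2) sᶜ ≤ ∫⁻ x, g x ∂P := by
  have hs : MeasurableSet {x | 1 ≤ g x} := measurableSet_le measurable_const hg
  refine ⟨{x | 1 ≤ g x}, hs, ?_, ?_⟩
  · simpa using mul_meas_ge_le_lintegral hg 1
  · rw [withDensity_apply _ hs.compl]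
    refine (setLIntegral_mono hg fun x hx => ?_).trans (setLIntegral_le_lintegral _ _)
    have hx' : g x ≤ 1 := (lt_of_not_ge fun hx' => hx hx').le
    calc g x ^ 2 = g x * g x := sq _
      _ ≤ g x * 1 := by gcongr
      _ = g x := mul_one _

lemma absolutelyContinuous_of_sq_le_mul {μ ν : Measure Ω} [IsFiniteMeasure μ] [IsFiniteMeasure ν]
    {𝒞 : Set (Set Ω)} (h𝒞 : IsSetRing 𝒞) (huniv : Set.univ ∈ 𝒞)
    (hgen : ‹MeasurableSpace Ω› = MeasurableSpace.generateFrom 𝒞) {C : ℝ≥0∞} (hC : C ≠ ∞)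
    (h : ∀ s ∈ 𝒞, ν s ^ 2 ≤ C * μ s) : ν ≪ μ := by
  refine Measure.AbsolutelyContinuous.mk fun N hN hμN => ?_
  have bound : ∀ ε : ℝ≥0∞, 0 < ε → ν N ≤ (C * ε) ^ (1 / 2 : ℝ) + ε := by
    intro ε hε
    obtain ⟨t, ht, hlt⟩ := exists_measure_symmDiff_lt_of_generateFrom_isSetRing (μ := μ + ν)
      h𝒞 ⟨{Set.univ}, by simp, by simpa using huniv, by simp⟩ hgen hN hε
    rw [Measure.add_apply] at hlt
    have hμt : μ t ≤ ε := calc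
      μ t ≤ μ ((t ∆ N) ∪ N) := measure_mono fun x hx => by
        by_cases hxN : x ∈ N
        · exact Or.inr hxN
        · exact Or.inl (Or.inl ⟨hx, hxN⟩)
      _ ≤ μ (t ∆ N) + μ N := measure_union_le _ _
      _ ≤ ε := by rw [hμN, add_zero]; exact le_self_add.trans hlt.le
    have hνt : ν t ≤ (C * ε) ^ (1 / 2 : ℝ) := by
      rw [one_div, ENNReal.le_rpow_inv_iff two_pos, ENNReal.rpow_two]
      exact (h t ht).trans (by gcongr)
    calc ν N ≤ ν (t ∪ (t ∆ N)) := measure_mono fun x hx => by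
          by_cases hxt : x ∈ t
          · exact Or.inl hxt
          · exact Or.inr (Or.inr ⟨hx, hxt⟩)
      _ ≤ ν t + ν (t ∆ N) := measure_union_le _ _
      _ ≤ _ := add_le_add hνt (le_add_self.trans hlt.le)
  have hlim : Tendsto (fun ε : ℝ≥0∞ => (C * ε) ^ (1 / 2 : ℝ) + ε) (𝓝[>] 0) (𝓝 0) := by
    have hcont : Continuous fun ε : ℝ≥0∞ => (C * ε) ^ (1 / 2 : ℝ) + ε :=
      (ENNReal.continuous_rpow_const.comp (ENNReal.continuous_const_mul hC)).add continuous_id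
    simpa using (hcont.tendsto 0).mono_left nhdsWithin_le_nhds
  exact le_antisymm (ge_of_tendsto hlim (eventually_mem_nhdsWithin.mono bound)) zero_le

lemma mutuallySingular_of_forall_exists_le {μ ν : Measure Ω}
    (h : ∀ ε : ℝ≥0, 0 < ε → ∃ s, μ s ≤ ε ∧ ν sᶜ ≤ ε) : μ ⟂ₘ ν := by
  refine Measure.mutuallySingular_of_disjoint fun ξ hξμ hξν => ?_
  refine (Measure.measure_univ_eq_zero.1 (le_antisymm ?_ zero_le)).le
  refine ENNReal.le_of_forall_pos_le_add fun ε hε _ => ?_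
  obtain ⟨s, hμs, hνs⟩ := h (ε / 2) (half_pos hε)
  calc ξ Set.univ = ξ (s ∪ sᶜ) := by rw [Set.union_compl_self]
    _ ≤ ξ s + ξ sᶜ := measure_union_le _ _
    _ ≤ (ε / 2 : ℝ≥0) + (ε / 2 : ℝ≥0) := add_le_add ((hξμ s).trans hμs) ((hξν _).trans hνs)
    _ = 0 + ε := by rw [← ENNReal.coe_add, add_halves, zero_add]

end General

section Product

variable {ι : Type*} {X : ι → Type*} [∀ i, MeasurableSpace (X i)]
  (m : ∀ i, Measure (X i)) [∀ i, IsProbabilityMeasure (m i)]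

lemma lintegral_pi_prod [Fintype ι] {f : ∀ i, X i → ℝ≥0∞} (hf : ∀ i, Measurable (f i)) :
    ∫⁻ x, ∏ i, f i (x i) ∂Measure.pi m = ∏ i, ∫⁻ y, f i y ∂m i := by
  rw [← Measure.infinitePi_eq_pi, ProbabilityTheory.lintegral_prod_eq_prod_lintegral_of_indepFun Finset.univ
    (fun i (x : ∀ i, X i) => f i (x i)) (ProbabilityTheory.iIndepFun_infinitePi hf) fun i => (hf i).comp (measurable_pi_apply i)]
  refine Finset.prod_congr rfl fun i _ => ?_
  exact (measurePreserving_eval_infinitePi m i).lintegral_comp (hf i)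

lemma pi_withDensity [Fintype ι] {r : ∀ i, X i → ℝ≥0∞} (hr : ∀ i, Measurable (r i))
    [∀ i, IsProbabilityMeasure ((m i).withDensity (r i))] :
    Measure.pi (fun i => (m i).withDensity (r i)) =
      (Measure.pi m).withDensity fun x => ∏ i, r i (x i) := by
  refine Measure.pi_eq fun t ht => ?_
  rw [withDensity_apply _ (.univ_pi ht), ← lintegral_indicator (.univ_pi ht)]
  have hind (x : ∀ i, X i) : (Set.univ.pi t).indicator (fun x => ∏ i, r i (x i)) x =
      ∏ i, (t i).indicator (r i) (x i) := by
    by_cases hx : x ∈ Set.univ.pi t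
    · rw [Set.indicator_of_mem hx]
      exact Finset.prod_congr rfl fun i _ => (Set.indicator_of_mem (hx i trivial) _).symm
    · obtain ⟨i, hi⟩ : ∃ i, x i ∉ t i := by simpa using hx
      rw [Set.indicator_of_notMem hx,
        Finset.prod_eq_zero (Finset.mem_univ i) (Set.indicator_of_notMem hi _)]
  simp_rw [hind]
  rw [lintegral_pi_prod m fun i => (hr i).indicator (ht i)]
  refine Finset.prod_congr rfl fun i _ => ?_
  rw [lintegral_indicator (ht i), withDensity_apply _ (ht i)]

/-- A product of measures with densities `r i` is absolutely continuous as soon as the second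
moments of the finite products of densities are bounded. -/
theorem infinitePi_withDensity_absolutelyContinuous {r : ∀ i, X i → ℝ≥0∞}
    (hr : ∀ i, Measurable (r i)) [∀ i, IsProbabilityMeasure ((m i).withDensity (r i))]
    {C : ℝ≥0∞} (hC : C ≠ ∞) (h : ∀ s : Finset ι, ∏ i ∈ s, ∫⁻ y, r i y ^ 2 ∂m i ≤ C) :
    Measure.infinitePi (fun i => (m i).withDensity (r i)) ≪ Measure.infinitePi m := by
  refine absolutelyContinuous_of_sq_le_mul isSetRing_measurableCylinders
    (univ_mem_measurableCylinders X) generateFrom_measurableCylinders.symm hC fun A hA => ?_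
  obtain ⟨s, S, hS, rfl⟩ := (mem_measurableCylinders A).1 hA
  rw [Measure.infinitePi_cylinder _ hS, Measure.infinitePi_cylinder _ hS,
    pi_withDensity (fun i : s => m i) fun i => hr i]
  refine (sq_withDensity_apply_le _ (by fun_prop) hS).trans ?_
  gcongr
  simp_rw [← Finset.prod_pow]
  rw [lintegral_pi_prod (fun i : s => m i) (f := fun i y => r i y ^ 2) fun i => (hr i).pow_const 2,
    Finset.prod_coe_sort s fun i => ∫⁻ y, r i y ^ 2 ∂m i]
  exact h s

/-- Products of measures with densities `g i ^ 2` are singular as soon as the products of the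
Hellinger affinities are arbitrarily small. -/
theorem mutuallySingular_infinitePi_withDensity_sq {g : ∀ i, X i → ℝ≥0∞}
    (hg : ∀ i, Measurable (g i))
    [∀ i, IsProbabilityMeasure ((m i).withDensity fun y => g i y ^ 2)]
    (h : ∀ ε : ℝ≥0, 0 < ε → ∃ s : Finset ι, ∏ i ∈ s, ∫⁻ y, g i y ∂m i ≤ ε) :
    Measure.infinitePi m ⟂ₘ Measure.infinitePi fun i => (m i).withDensity fun y => g i y ^ 2 := by
  refine mutuallySingular_of_forall_exists_le fun ε hε => ?_
  obtain ⟨s, hs⟩ := h ε hε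
  rw [← Finset.prod_coe_sort s fun i => ∫⁻ y, g i y ∂m i,
    ← lintegral_pi_prod (fun i : s => m i) (f := fun i => g i) fun i => hg i] at hs
  obtain ⟨S, hS, hPS, hQS⟩ := exists_measure_le_lintegral_withDensity_sq
    (Measure.pi fun i : s => m i) (g := fun x => ∏ i : s, g i (x i)) (by fun_prop)
  simp_rw [← Finset.prod_pow] at hQS
  rw [← pi_withDensity (fun i : s => m i) (r := fun i y => g i y ^ 2)
    fun i => (hg i).pow_const 2] at hQS
  refine ⟨cylinder s S, ?_, ?_⟩
  · rw [Measure.infinitePi_cylinder _ hS]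
    exact hPS.trans hs
  · rw [compl_cylinder, Measure.infinitePi_cylinder _ hS.compl]
    exact hQS.trans hs

end Product

section Cauchy

/-- The Lebesgue density of the Cauchy distribution with location `δ` and scale `γ`. -/
noncomputable def cauchyDensity (δ γ x : ℝ) : ℝ := (γ * Real.pi)⁻¹ * (1 + ((x - δ) / γ) ^ 2)⁻¹

lemma cauchyMeasure_eq_withDensity (δ γ : ℝ) :
    cauchyMeasure δ γ = volume.withDensity fun x => ENNReal.ofReal (cauchyDensity δ γ x) := rfl

@[fun_prop]
lemma measurable_cauchyDensity (δ γ : ℝ) : Measurable (cauchyDensity δ γ) := by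
  unfold cauchyDensity
  fun_prop

lemma cauchyDensity_pos (δ : ℝ) {γ : ℝ} (hγ : 0 < γ) (x : ℝ) : 0 < cauchyDensity δ γ x := by
  unfold cauchyDensity
  have := Real.pi_pos
  positivity

lemma lintegral_cauchyDensity (δ : ℝ) {γ : ℝ} (hγ : 0 < γ) :
    ∫⁻ x, ENNReal.ofReal (cauchyDensity δ γ x) = 1 := by
  lift γ to ℝ≥0 using hγ.le
  rw [← ProbabilityTheory.lintegral_cauchyPDF_eq_one δ (γ := γ) (by simpa using hγ.ne')]
  refine lintegral_congr fun x => ?_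
  rw [ProbabilityTheory.cauchyPDF_def, ProbabilityTheory.cauchyPDFReal_def', cauchyDensity,
    mul_inv_rev, NNReal.coe_inv]

lemma isProbabilityMeasure_cauchyMeasure (δ : ℝ) {γ : ℝ} (hγ : 0 < γ) :
    IsProbabilityMeasure (cauchyMeasure δ γ) := by
  constructor
  rw [cauchyMeasure_eq_withDensity, withDensity_apply _ .univ, setLIntegral_univ,
    lintegral_cauchyDensity δ hγ]

lemma lintegral_cauchyMeasure (δ : ℝ) {γ : ℝ} (hγ : 0 < γ) {f : ℝ → ℝ} (hf : Measurable f) :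
    ∫⁻ x, ENNReal.ofReal (f x) ∂cauchyMeasure δ γ =
      ∫⁻ x, ENNReal.ofReal (cauchyDensity δ γ x * f x) := by
  rw [cauchyMeasure_eq_withDensity,
    lintegral_withDensity_eq_lintegral_mul _ (by fun_prop) (by fun_prop)]
  refine lintegral_congr fun x => ?_
  rw [Pi.mul_apply, ENNReal.ofReal_mul (cauchyDensity_pos δ hγ x).le]

lemma cauchyMeasure_withDensity_div (a b : ℝ) {γ : ℝ} (hγ : 0 < γ) :
    (cauchyMeasure a γ).withDensity
      (fun x => ENNReal.ofReal (cauchyDensity b γ x / cauchyDensity a γ x)) =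
      cauchyMeasure b γ := by
  rw [cauchyMeasure_eq_withDensity, cauchyMeasure_eq_withDensity,
    ← withDensity_mul _ (by fun_prop) (by fun_prop)]
  congr with x
  have hp := cauchyDensity_pos a hγ x
  rw [Pi.mul_apply, ← ENNReal.ofReal_mul hp.le, mul_div_cancel₀ _ hp.ne']

lemma cauchyDensity_sq_div_add_reflection_le (a b : ℝ) {γ : ℝ} (hγ : 0 < γ) (x : ℝ) :
    cauchyDensity b γ x ^ 2 / cauchyDensity a γ x +
      cauchyDensity b γ (2 * b - x) ^ 2 / cauchyDensity a γ (2 * b - x) ≤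
      2 * (1 + ((b - a) / γ) ^ 2) * cauchyDensity b γ x := by
  have hπ := Real.pi_pos
  obtain ⟨y, rfl⟩ : ∃ y, x = b + γ * y := ⟨(x - b) / γ, by field_simp; ring⟩
  obtain ⟨t, ht⟩ : ∃ t, b = a + γ * t := ⟨(b - a) / γ, by field_simp; ring⟩
  have h1 : (b + γ * y - b) / γ = y := by field_simp; ring
  have h2 : (2 * b - (b + γ * y) - b) / γ = -y := by field_simp; ring
  have h3 : (b + γ * y - a) / γ = t + y := by rw [ht]; field_simp; ring
  have h4 : (2 * b - (b + γ * y) - a) / γ = t - y := by rw [ht]; field_simp; ring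
  have h5 : (b - a) / γ = t := by rw [ht]; field_simp; ring
  simp only [cauchyDensity, h1, h2, h3, h4, h5]
  have hdiff : 2 * (1 + t ^ 2) * ((γ * Real.pi)⁻¹ * (1 + y ^ 2)⁻¹) -
      (((γ * Real.pi)⁻¹ * (1 + y ^ 2)⁻¹) ^ 2 / ((γ * Real.pi)⁻¹ * (1 + (t + y) ^ 2)⁻¹) +
      ((γ * Real.pi)⁻¹ * (1 + (-y) ^ 2)⁻¹) ^ 2 / ((γ * Real.pi)⁻¹ * (1 + (t - y) ^ 2)⁻¹)) =
      (γ * Real.pi)⁻¹ * (2 * t ^ 2 * y ^ 2) / (1 + y ^ 2) ^ 2 := by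
    rw [neg_sq]
    have : 1 + y ^ 2 ≠ 0 := by positivity
    have : 1 + (t + y) ^ 2 ≠ 0 := by positivity
    have : 1 + (t - y) ^ 2 ≠ 0 := by positivity
    field_simp
    ring
  have : 0 ≤ (γ * Real.pi)⁻¹ * (2 * t ^ 2 * y ^ 2) / (1 + y ^ 2) ^ 2 := by positivity
  linarith

lemma lintegral_sq_cauchyDensity_div_le (a b : ℝ) {γ : ℝ} (hγ : 0 < γ) :
    ∫⁻ x, ENNReal.ofReal (cauchyDensity b γ x / cauchyDensity a γ x) ^ 2 ∂cauchyMeasure a γ ≤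
      ENNReal.ofReal (1 + ((b - a) / γ) ^ 2) := by
  set F : ℝ → ℝ := fun x => cauchyDensity b γ x ^ 2 / cauchyDensity a γ x with hF
  have hFm : Measurable F := by fun_prop
  have hF0 (x : ℝ) : 0 ≤ F x := div_nonneg (sq_nonneg _) (cauchyDensity_pos a hγ x).le
  have hc : 0 ≤ 2 * (1 + ((b - a) / γ) ^ 2) := by positivity
  have hint : ∫⁻ x, ENNReal.ofReal (cauchyDensity b γ x / cauchyDensity a γ x) ^ 2
      ∂cauchyMeasure a γ = ∫⁻ x, ENNReal.ofReal (F x) := by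
    simp_rw [fun x => (ENNReal.ofReal_pow
      (div_pos (cauchyDensity_pos b hγ x) (cauchyDensity_pos a hγ x)).le 2).symm]
    rw [lintegral_cauchyMeasure a hγ (by fun_prop)]
    refine lintegral_congr fun x => ?_
    have := (cauchyDensity_pos a hγ x).ne'
    congr 1
    simp only [hF]
    field_simp
  rw [hint, ← ENNReal.mul_le_mul_iff_right two_ne_zero ENNReal.ofNat_ne_top]
  calc 2 * ∫⁻ x, ENNReal.ofReal (F x)
      = (∫⁻ x, ENNReal.ofReal (F x)) + ∫⁻ x, ENNReal.ofReal (F (2 * b - x)) := by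
        rw [lintegral_sub_left_eq_self (fun x => ENNReal.ofReal (F x)) (2 * b), two_mul]
    _ = ∫⁻ x, ENNReal.ofReal (F x + F (2 * b - x)) := by
        rw [← lintegral_add_left (by fun_prop)]
        exact lintegral_congr fun x => (ENNReal.ofReal_add (hF0 _) (hF0 _)).symm
    _ ≤ ∫⁻ x, ENNReal.ofReal (2 * (1 + ((b - a) / γ) ^ 2) * cauchyDensity b γ x) :=
        lintegral_mono fun x =>
          ENNReal.ofReal_le_ofReal (cauchyDensity_sq_div_add_reflection_le a b hγ x)
    _ = 2 * ENNReal.ofReal (1 + ((b - a) / γ) ^ 2) := by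
        simp_rw [ENNReal.ofReal_mul hc]
        rw [lintegral_const_mul _ (by fun_prop), lintegral_cauchyDensity b hγ, mul_one,
          ENNReal.ofReal_mul two_pos.le, ENNReal.ofReal_ofNat]

/-- The harmonic mean of two Cauchy densities with the same scale is a multiple of a Cauchy
density. -/
lemma harmonicMean_cauchyDensity (a b : ℝ) {γ : ℝ} (hγ : 0 < γ) (x : ℝ) :
    2 * (cauchyDensity a γ x * cauchyDensity b γ x) / (cauchyDensity a γ x + cauchyDensity b γ x) =
      (√(1 + ((b - a) / γ) ^ 2 / 4))⁻¹ *
        cauchyDensity ((a + b) / 2) (γ * √(1 + ((b - a) / γ) ^ 2 / 4)) x := by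
  have hπ := Real.pi_pos
  obtain ⟨y, rfl⟩ : ∃ y, x = a + γ * y := ⟨(x - a) / γ, by field_simp; ring⟩
  obtain ⟨t, rfl⟩ : ∃ t, b = a + γ * t := ⟨(b - a) / γ, by field_simp; ring⟩
  have h1 : (a + γ * y - a) / γ = y := by field_simp; ring
  have h2 : (a + γ * y - (a + γ * t)) / γ = y - t := by field_simp; ring
  have h3 : (a + γ * t - a) / γ = t := by field_simp; ring
  simp only [cauchyDensity, h1, h2, h3]
  have hs : 0 < √(1 + t ^ 2 / 4) := by positivity
  have hs2 : √(1 + t ^ 2 / 4) ^ 2 = 1 + t ^ 2 / 4 := Real.sq_sqrt (by positivity)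
  set w := √(1 + t ^ 2 / 4)
  have h4 : (a + γ * y - (a + (a + γ * t)) / 2) / (γ * w) = (y - t / 2) / w := by
    field_simp; ring
  rw [h4]
  have e1 : (1 + ((y - t / 2) / w) ^ 2)⁻¹ = w ^ 2 / (1 + y ^ 2 - t * y + t ^ 2 / 2) := by
    have : 1 + y ^ 2 - t * y + t ^ 2 / 2 = w ^ 2 + (y - t / 2) ^ 2 := by rw [hs2]; ring
    rw [this]
    field_simp
  rw [e1]
  have hA : 1 + y ^ 2 ≠ 0 := by positivity
  have hB : 1 + (y - t) ^ 2 ≠ 0 := by positivity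
  have hC : 1 + y ^ 2 - t * y + t ^ 2 / 2 ≠ 0 := by nlinarith [sq_nonneg (y - t / 2), sq_nonneg t]
  have hD : (1 + y ^ 2) + (1 + (y - t) ^ 2) ≠ 0 := by positivity
  have e2 : (γ * Real.pi)⁻¹ * (1 + y ^ 2)⁻¹ + (γ * Real.pi)⁻¹ * (1 + (y - t) ^ 2)⁻¹ =
      (γ * Real.pi)⁻¹ * (2 * (1 + y ^ 2 - t * y + t ^ 2 / 2)) /
        ((1 + y ^ 2) * (1 + (y - t) ^ 2)) := by
    field_simp
    ring
  rw [e2]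
  field_simp

lemma sq_lintegral_sqrt_cauchyDensity_div_le (a b : ℝ) {γ : ℝ} (hγ : 0 < γ) :
    (∫⁻ x, ENNReal.ofReal √(cauchyDensity b γ x / cauchyDensity a γ x) ∂cauchyMeasure a γ) ^ 2 ≤
      ENNReal.ofReal (√(1 + ((b - a) / γ) ^ 2 / 4))⁻¹ := by
  set p := cauchyDensity a γ with hp
  set q := cauchyDensity b γ with hq
  have hpm : Measurable p := measurable_cauchyDensity a γ
  have hqm : Measurable q := measurable_cauchyDensity b γ
  have hp0 : ∀ x, 0 < p x := cauchyDensity_pos a hγ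
  have hq0 : ∀ x, 0 < q x := cauchyDensity_pos b hγ
  set w := √(1 + ((b - a) / γ) ^ 2 / 4) with hw
  have hw0 : 0 < w := by positivity
  have hH : ∫⁻ x, ENNReal.ofReal (2 * (p x * q x) / (p x + q x)) = ENNReal.ofReal w⁻¹ := by
    simp_rw [hp, hq, harmonicMean_cauchyDensity a b hγ, ← hw, ENNReal.ofReal_mul (inv_pos.2 hw0).le]
    rw [lintegral_const_mul _ (by fun_prop), lintegral_cauchyDensity _ (mul_pos hγ hw0), mul_one]
  have hA : ∫⁻ x, ENNReal.ofReal ((p x + q x) / 2) = 1 := by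
    simp_rw [add_div, div_eq_inv_mul, fun x => ENNReal.ofReal_add
      (mul_nonneg (inv_pos.2 two_pos).le (hp0 x).le) (mul_nonneg (inv_pos.2 two_pos).le (hq0 x).le),
      ENNReal.ofReal_mul (inv_pos.2 (two_pos (α := ℝ))).le]
    rw [lintegral_add_left (by fun_prop), lintegral_const_mul _ (by fun_prop),
      lintegral_const_mul _ (by fun_prop), lintegral_cauchyDensity a hγ,
      lintegral_cauchyDensity b hγ, mul_one, ENNReal.ofReal_inv_of_pos two_pos,
      ENNReal.ofReal_ofNat, ENNReal.inv_two_add_inv_two]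
  rw [lintegral_cauchyMeasure a hγ (by fun_prop)]
  calc (∫⁻ x, ENNReal.ofReal (p x * √(q x / p x))) ^ 2
      = (∫⁻ x, ENNReal.ofReal √(2 * (p x * q x) / (p x + q x)) *
          ENNReal.ofReal √((p x + q x) / 2)) ^ 2 := by
        congr 1
        refine lintegral_congr fun x => ?_
        have h1 := hp0 x
        have h2 := hq0 x
        rw [← ENNReal.ofReal_mul (Real.sqrt_nonneg _), ← Real.sqrt_mul (by positivity)]
        congr 1
        rw [← Real.sqrt_sq h1.le, ← Real.sqrt_mul (sq_nonneg _), Real.sqrt_sq h1.le]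
        congr 1
        field_simp
    _ ≤ (∫⁻ x, ENNReal.ofReal √(2 * (p x * q x) / (p x + q x)) ^ 2) *
          ∫⁻ x, ENNReal.ofReal √((p x + q x) / 2) ^ 2 :=
        sq_lintegral_mul_le _ (by fun_prop) (by fun_prop)
    _ = ENNReal.ofReal w⁻¹ := by
        rw [← hH, ← mul_one (∫⁻ x, ENNReal.ofReal (2 * (p x * q x) / (p x + q x))), ← hA]
        congr 1 <;> refine lintegral_congr fun x => ?_
        all_goals
          have h1 := hp0 x
          have h2 := hq0 x
          rw [← ENNReal.ofReal_pow (Real.sqrt_nonneg _), Real.sq_sqrt (by positivity)]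

end Cauchy

lemma sum_le_prod_one_add {ι : Type*} (s : Finset ι) {f : ι → ℝ} (hf : ∀ i, 0 ≤ f i) :
    1 + ∑ i ∈ s, f i ≤ ∏ i ∈ s, (1 + f i) := by
  classical
  induction s using Finset.induction_on with
  | empty => simp
  | insert i s hi ih =>
    rw [Finset.sum_insert hi, Finset.prod_insert hi]
    nlinarith [hf i, Finset.sum_nonneg fun j (_ : j ∈ s) => hf j]

section CauchyProduct

variable {γ : ℕ → ℝ}

lemma IsProductMeasure.eq_infinitePi {μ : Measure (ℕ → ℝ)} {μs : ℕ → Measure ℝ}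
    [∀ n, IsProbabilityMeasure (μs n)] (hμ : IsProductMeasure μ μs) :
    μ = Measure.infinitePi μs :=
  Measure.eq_infinitePi μs fun s E hE => hμ s E hE

lemma infinitePi_cauchyMeasure_absolutelyContinuous (hγ : ∀ n, 0 < γ n) (a b : ℕ → ℝ)
    (h : Summable fun n => ((b n - a n) / γ n) ^ 2) :
    Measure.infinitePi (fun n => cauchyMeasure (b n) (γ n)) ≪
      Measure.infinitePi fun n => cauchyMeasure (a n) (γ n) := by
  have hprob (c : ℕ → ℝ) (n : ℕ) := isProbabilityMeasure_cauchyMeasure (c n) (hγ n)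
  have hdens (n : ℕ) := cauchyMeasure_withDensity_div (a n) (b n) (hγ n)
  have (n : ℕ) : IsProbabilityMeasure ((cauchyMeasure (a n) (γ n)).withDensity fun x =>
      ENNReal.ofReal (cauchyDensity (b n) (γ n) x / cauchyDensity (a n) (γ n) x)) := by
    rw [hdens]; infer_instance
  simp_rw [← hdens]
  refine infinitePi_withDensity_absolutelyContinuous _ (fun n => by fun_prop)
    (C := ENNReal.ofReal (Real.exp (∑' n, ((b n - a n) / γ n) ^ 2))) ENNReal.ofReal_ne_top
    fun s => ?_
  calc _ ≤ ∏ n ∈ s, ENNReal.ofReal (1 + ((b n - a n) / γ n) ^ 2) :=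
        Finset.prod_le_prod' fun n _ => lintegral_sq_cauchyDensity_div_le (a n) (b n) (hγ n)
    _ = ENNReal.ofReal (∏ n ∈ s, (1 + ((b n - a n) / γ n) ^ 2)) :=
        (ENNReal.ofReal_prod_of_nonneg fun n _ => by positivity).symm
    _ ≤ _ := ENNReal.ofReal_le_ofReal <|
        (Real.prod_one_add_le_exp_sum s fun n => sq_nonneg _).trans <|
          Real.exp_le_exp.2 <| h.sum_le_tsum s fun n _ => sq_nonneg _

lemma infinitePi_cauchyMeasure_mutuallySingular (hγ : ∀ n, 0 < γ n) (a b : ℕ → ℝ)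
    (h : ¬ Summable fun n => ((b n - a n) / γ n) ^ 2) :
    Measure.infinitePi (fun n => cauchyMeasure (a n) (γ n)) ⟂ₘ
      Measure.infinitePi fun n => cauchyMeasure (b n) (γ n) := by
  have hprob (c : ℕ → ℝ) (n : ℕ) := isProbabilityMeasure_cauchyMeasure (c n) (hγ n)
  have hdens (n : ℕ) : (cauchyMeasure (a n) (γ n)).withDensity (fun x =>
      ENNReal.ofReal √(cauchyDensity (b n) (γ n) x / cauchyDensity (a n) (γ n) x) ^ 2) =
      cauchyMeasure (b n) (γ n) := by
    rw [← cauchyMeasure_withDensity_div (a n) (b n) (hγ n)]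
    congr with x
    rw [← ENNReal.ofReal_pow (Real.sqrt_nonneg _), Real.sq_sqrt
      (div_pos (cauchyDensity_pos _ (hγ n) x) (cauchyDensity_pos _ (hγ n) x)).le]
  have (n : ℕ) : IsProbabilityMeasure ((cauchyMeasure (a n) (γ n)).withDensity fun x =>
      ENNReal.ofReal √(cauchyDensity (b n) (γ n) x / cauchyDensity (a n) (γ n) x) ^ 2) := by
    rw [hdens]; infer_instance
  simp_rw [← hdens]
  refine mutuallySingular_infinitePi_withDensity_sq _ (fun n => by fun_prop) fun ε hε => ?_
  obtain ⟨s, hs⟩ : ∃ s : Finset ℕ, 4 * ((ε : ℝ) ^ 4)⁻¹ < ∑ n ∈ s, ((b n - a n) / γ n) ^ 2 := by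
    by_contra! hle
    exact h (summable_of_sum_le (fun n => sq_nonneg _) hle)
  refine ⟨s, ?_⟩
  have hε' : (0 : ℝ) < ε := hε
  rw [← ENNReal.pow_le_pow_left_iff four_ne_zero]
  calc _ = ∏ n ∈ s, ((∫⁻ x, ENNReal.ofReal √(cauchyDensity (b n) (γ n) x /
          cauchyDensity (a n) (γ n) x) ∂cauchyMeasure (a n) (γ n)) ^ 2) ^ 2 := by
        rw [← Finset.prod_pow]
        simp_rw [← pow_mul]
    _ ≤ ∏ n ∈ s, ENNReal.ofReal (1 + ((b n - a n) / γ n) ^ 2 / 4)⁻¹ := by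
        refine Finset.prod_le_prod' fun n _ => ?_
        refine (pow_le_pow_left'
          (sq_lintegral_sqrt_cauchyDensity_div_le (a n) (b n) (hγ n)) 2).trans_eq ?_
        rw [← ENNReal.ofReal_pow (by positivity), inv_pow, Real.sq_sqrt (by positivity)]
    _ = ENNReal.ofReal (∏ n ∈ s, (1 + ((b n - a n) / γ n) ^ 2 / 4))⁻¹ := by
        rw [← ENNReal.ofReal_prod_of_nonneg fun n _ => by positivity, Finset.prod_inv_distrib]
    _ ≤ ENNReal.ofReal ((ε : ℝ) ^ 4) := by
        refine ENNReal.ofReal_le_ofReal (inv_le_of_inv_le₀ (by positivity) ?_)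
        have := sum_le_prod_one_add s (f := fun n => ((b n - a n) / γ n) ^ 2 / 4)
          fun n => by positivity
        rw [← Finset.sum_div] at this
        linarith
    _ = (ε : ℝ≥0∞) ^ 4 := by rw [ENNReal.ofReal_pow hε'.le, ENNReal.ofReal_coe_nnreal]

end CauchyProduct

/-- A Cameron–Martin-type dichotomy for infinite products of Cauchy measures: the product
`μ = ⨂ₙ C(0, γₙ)` and its shifted version `ν = ⨂ₙ C(hₙ, γₙ)` are mutually absolutely
continuous if and only if `∑ₙ (hₙ/γₙ)² < ∞`, and otherwise they are mutually singular. -/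
theorem cauchy_product_equivalence_dichotomy
    (γ : ℕ → ℝ) (hγ : ∀ n, 0 < γ n) (h : ℕ → ℝ)
    (μ ν : Measure (ℕ → ℝ)) [IsProbabilityMeasure μ] [IsProbabilityMeasure ν]
    (hμ : IsProductMeasure μ fun n => cauchyMeasure 0 (γ n))
    (hν : IsProductMeasure ν fun n => cauchyMeasure (h n) (γ n)) :
    ((μ ≪ ν ∧ ν ≪ μ) ↔ Summable fun n => (h n / γ n) ^ 2) ∧
    (¬ (Summable fun n => (h n / γ n) ^ 2) → μ ⟂ₘ ν) := by
  have hprob (c : ℕ → ℝ) (n : ℕ) := isProbabilityMeasure_cauchyMeasure (c n) (hγ n)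
  have hprob₀ (n : ℕ) := hprob (fun _ => 0) n
  obtain rfl := hμ.eq_infinitePi
  obtain rfl := hν.eq_infinitePi
  have hsing (hs : ¬ Summable fun n => (h n / γ n) ^ 2) :=
    infinitePi_cauchyMeasure_mutuallySingular hγ (fun _ => 0) h (by simpa using hs)
  refine ⟨⟨fun hac => ?_, fun hs => ⟨?_, ?_⟩⟩, hsing⟩
  · by_contra hs
    exact NeZero.ne _ (Measure.eq_zero_of_absolutelyContinuous_of_mutuallySingular hac.1 (hsing hs))
  · exact infinitePi_cauchyMeasure_absolutelyContinuous hγ h (fun _ => 0)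
      (by simpa [neg_div] using hs)
  · exact infinitePi_cauchyMeasure_absolutelyContinuous hγ (fun _ => 0) h (by simpa using hs)
end

section
/- Let 𝒰 and 𝒴 be real separable Banach spaces, μ₀ a Borel probability measure on 𝒰, Φ : 𝒰 × 𝒴 → ℝ satisfying (A0) and (A1), and y ∈ 𝒴. Suppose that for some r > ‖y‖ the integrability condition S_{1,r} := ∫_𝒰 exp(−M_{1,r}(‖u‖)) dμ₀(u) < ∞ holds. Then Z(y) := ∫_𝒰 exp(−Φ(u;y)) dμ₀(u) satisfies 0 < Z(y) < ∞, and the measure μ^y defined by dμ^y/dμ₀(u) = exp(−Φ(u;y))/Z(y) is a Borel probability measure on 𝒰 which is inner regular with respect to compact sets, i.e. μ^y(E) = sup{μ^y(K) : K ⊆ E, K compact} for every Borel set E ⊆ 𝒰. -/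
open MeasureTheory

variable {U : Type*} [MeasurableSpace U]

/-- The Bayesian posterior for prior `μ₀`, misfit `Φ` and data `y`: the measure with density
`exp(-Φ(u;y)) / Z(y)` with respect to `μ₀`, where `Z(y) = ∫ exp(-Φ(u;y)) dμ₀(u)`. -/
noncomputable def posteriorMeasure {Y : Type*} (μ₀ : Measure U) (Φ : U → Y → ℝ) (y : Y) :
    Measure U :=
  μ₀.withDensity fun u =>
    ENNReal.ofReal (Real.exp (-Φ u y)) / ∫⁻ v, ENNReal.ofReal (Real.exp (-Φ v y)) ∂μ₀

/-- Well-definedness of the Bayesian posterior: under (A0), (A1) and the integrability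
condition `S_{1,r} < ∞` for some `r > ‖y‖`, the normalising constant
`Z(y) = ∫ exp(-Φ(u;y)) dμ₀(u)` is strictly positive and finite, and the posterior
`dμ^y/dμ₀ = exp(-Φ(·;y))/Z(y)` is a Borel probability measure on `U` that is inner regular
with respect to compact sets. -/
theorem posterior_well_defined
    {U Y : Type*}
    [NormedAddCommGroup U] [NormedSpace ℝ U] [CompleteSpace U]
    [TopologicalSpace.SeparableSpace U] [MeasurableSpace U] [BorelSpace U]
    [NormedAddCommGroup Y] [NormedSpace ℝ Y] [CompleteSpace Y]
    [TopologicalSpace.SeparableSpace Y]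
    (μ₀ : Measure U) [IsProbabilityMeasure μ₀]
    (Φ : U → Y → ℝ)
    -- (A0)
    (hA0cont : ∀ u, Continuous (Φ u))
    (hA0meas : ∀ y, Measurable fun u => Φ u y)
    (hA0bdd : ∀ r > (0 : ℝ), ∃ M₀ : ℝ, ∀ u y, ‖u‖ < r → ‖y‖ < r → |Φ u y| ≤ M₀)
    -- (A1)
    (M₁ : ℝ → ℝ → ℝ)
    (hA1meas : ∀ r > (0 : ℝ), Measurable (M₁ r))
    (hA1 : ∀ r > (0 : ℝ), ∀ u y, ‖y‖ < r → M₁ r ‖u‖ ≤ Φ u y)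
    -- data and integrability
    (y : Y) (r : ℝ) (hry : ‖y‖ < r)
    (hS : (∫⁻ u, ENNReal.ofReal (Real.exp (-(M₁ r ‖u‖))) ∂μ₀) < ⊤) :
    (0 < ∫⁻ u, ENNReal.ofReal (Real.exp (-Φ u y)) ∂μ₀) ∧
    ((∫⁻ u, ENNReal.ofReal (Real.exp (-Φ u y)) ∂μ₀) < ⊤) ∧
    IsProbabilityMeasure (posteriorMeasure μ₀ Φ y) ∧
    (∀ E : Set U, MeasurableSet E →
      posteriorMeasure μ₀ Φ y E =
        ⨆ (K : Set U) (_ : K ⊆ E) (_ : IsCompact K), posteriorMeasure μ₀ Φ y K) := by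
  have hr : 0 < r := (norm_nonneg y).trans_lt hry
  have hmeas : Measurable fun u => ENNReal.ofReal (Real.exp (-Φ u y)) :=
    (hA0meas y).neg.exp.ennreal_ofReal
  have hpos : 0 < ∫⁻ u, ENNReal.ofReal (Real.exp (-Φ u y)) ∂μ₀ := by
    have hsupp : (Function.support fun u => ENNReal.ofReal (Real.exp (-Φ u y))) = Set.univ :=
      Set.eq_univ_of_forall fun u => (ENNReal.ofReal_pos.2 (Real.exp_pos _)).ne'
    rw [lintegral_pos_iff_support hmeas, hsupp, measure_univ]
    exact one_pos
  have hfin : ∫⁻ u, ENNReal.ofReal (Real.exp (-Φ u y)) ∂μ₀ < ⊤ := by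
    refine lt_of_le_of_lt (lintegral_mono fun u => ?_) hS
    exact ENNReal.ofReal_le_ofReal (Real.exp_le_exp.2 (neg_le_neg (hA1 r hr u y hry)))
  have hprob : IsProbabilityMeasure (posteriorMeasure μ₀ Φ y) := by
    refine ⟨?_⟩
    rw [posteriorMeasure, withDensity_apply _ MeasurableSet.univ, Measure.restrict_univ]
    simp only [div_eq_mul_inv]
    rw [lintegral_mul_const _ hmeas, ENNReal.mul_inv_cancel hpos.ne' hfin.ne]
  have : SecondCountableTopology U := UniformSpace.secondCountable_of_separable U
  exact ⟨hpos, hfin, hprob, fun E hE => hE.measure_eq_iSup_isCompact _⟩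
end

section
/- Let 𝒰 and 𝒴 be real separable Banach spaces, μ₀ a Borel probability measure on 𝒰, and Φ : 𝒰 × 𝒴 → ℝ satisfying (A0), (A1) and (A2). Let r > 0 be such that S_{1,2,r} := ∫_𝒰 exp(2·M_{2,r}(‖u‖) − M_{1,r}(‖u‖)) dμ₀(u) < ∞. Then there exists a constant C (depending on r, S_{1,2,r}, and the data in (A0)–(A2)) such that for all y, y' ∈ 𝒴 with ‖y‖ < r and ‖y'‖ < r, the normalising constants Z(y) := ∫_𝒰 exp(−Φ(u;y)) dμ₀(u) satisfy |Z(y) − Z(y')| ≤ C·‖y − y'‖. -/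
open MeasureTheory

/-- On `[m, ∞)` the function `t ↦ exp (-t)` is Lipschitz with constant `exp (-m)`. -/
theorem Real.abs_exp_neg_sub_exp_neg_le {m a b : ℝ} (ha : m ≤ a) (hb : m ≤ b) :
    |Real.exp (-a) - Real.exp (-b)| ≤ Real.exp (-m) * |a - b| := by
  wlog hab : a ≤ b generalizing a b
  · rw [abs_sub_comm, abs_sub_comm a b]
    exact this hb ha (le_of_not_ge hab)
  rw [abs_of_nonneg (sub_nonneg.2 (Real.exp_le_exp.2 (neg_le_neg hab))), abs_sub_comm a b,
    abs_of_nonneg (sub_nonneg.2 hab)]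
  calc Real.exp (-a) - Real.exp (-b) = Real.exp (-a) * (1 - Real.exp (a - b)) := by
        rw [mul_sub, mul_one, ← Real.exp_add]
        ring_nf
    _ ≤ Real.exp (-a) * (b - a) := by
        refine mul_le_mul_of_nonneg_left ?_ (Real.exp_pos _).le
        linarith [Real.add_one_le_exp (a - b)]
    _ ≤ Real.exp (-m) * (b - a) := by
        have := sub_nonneg.2 hab
        gcongr

/-- Lipschitz continuity of the normalising constant `Z(y) = ∫ exp(-Φ(u;y)) dμ₀(u)` with
respect to the data `y`: under (A0)--(A2) and the integrability condition `S_{1,2,r} < ∞`,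
there is a constant `C` with `|Z(y) - Z(y')| ≤ C ‖y - y'‖` whenever `‖y‖, ‖y'‖ < r`. -/
theorem normalising_constant_lipschitz
    {U Y : Type*}
    [NormedAddCommGroup U] [NormedSpace ℝ U] [CompleteSpace U]
    [TopologicalSpace.SeparableSpace U] [MeasurableSpace U] [BorelSpace U]
    [NormedAddCommGroup Y] [NormedSpace ℝ Y] [CompleteSpace Y]
    [TopologicalSpace.SeparableSpace Y]
    (μ₀ : Measure U) [IsProbabilityMeasure μ₀]
    (Φ : U → Y → ℝ)
    -- (A0)
    (hA0cont : ∀ u, Continuous (Φ u))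
    (hA0meas : ∀ y, Measurable fun u => Φ u y)
    (hA0bdd : ∀ r > (0 : ℝ), ∃ M₀ : ℝ, ∀ u y, ‖u‖ < r → ‖y‖ < r → |Φ u y| ≤ M₀)
    -- (A1)
    (M₁ : ℝ → ℝ → ℝ)
    (hA1meas : ∀ r > (0 : ℝ), Measurable (M₁ r))
    (hA1 : ∀ r > (0 : ℝ), ∀ u y, ‖y‖ < r → M₁ r ‖u‖ ≤ Φ u y)
    -- (A2)
    (M₂ : ℝ → ℝ → ℝ)
    (hA2meas : ∀ r > (0 : ℝ), Measurable (M₂ r))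
    (hA2nonneg : ∀ r > (0 : ℝ), ∀ t : ℝ, 0 ≤ M₂ r t)
    (hA2 : ∀ r > (0 : ℝ), ∀ u y₁ y₂, ‖y₁‖ < r → ‖y₂‖ < r →
      |Φ u y₁ - Φ u y₂| ≤ Real.exp (M₂ r ‖u‖) * ‖y₁ - y₂‖)
    -- integrability
    (r : ℝ) (hr : 0 < r)
    (hS : Integrable (fun u => Real.exp (2 * M₂ r ‖u‖ - M₁ r ‖u‖)) μ₀) :
    ∃ C : ℝ, ∀ y y' : Y, ‖y‖ < r → ‖y'‖ < r →
      |(∫ u, Real.exp (-Φ u y) ∂μ₀) - ∫ u, Real.exp (-Φ u y') ∂μ₀| ≤ C * ‖y - y'‖ := by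
  have hint : ∀ y : Y, ‖y‖ < r → Integrable (fun u => Real.exp (-Φ u y)) μ₀ := by
    intro y hy
    refine hS.mono' (hA0meas y).neg.exp.aestronglyMeasurable (Filter.Eventually.of_forall ?_)
    intro u
    rw [Real.norm_eq_abs, Real.abs_exp, Real.exp_le_exp]
    linarith [hA1 r hr u y hy, hA2nonneg r hr ‖u‖]
  refine ⟨∫ u, Real.exp (2 * M₂ r ‖u‖ - M₁ r ‖u‖) ∂μ₀, fun y y' hy hy' => ?_⟩
  rw [← integral_sub (hint y hy) (hint y' hy'), ← integral_mul_const, ← Real.norm_eq_abs]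
  refine norm_integral_le_of_norm_le (hS.mul_const _) (Filter.Eventually.of_forall fun u => ?_)
  calc |Real.exp (-Φ u y) - Real.exp (-Φ u y')|
      ≤ Real.exp (-M₁ r ‖u‖) * |Φ u y - Φ u y'| :=
        Real.abs_exp_neg_sub_exp_neg_le (hA1 r hr u y hy) (hA1 r hr u y' hy')
    _ ≤ Real.exp (-M₁ r ‖u‖) * (Real.exp (M₂ r ‖u‖) * ‖y - y'‖) := by
        gcongr
        exact hA2 r hr u y y' hy hy'
    _ = Real.exp (M₂ r ‖u‖ - M₁ r ‖u‖) * ‖y - y'‖ := by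
        rw [← mul_assoc, ← Real.exp_add, neg_add_eq_sub]
    _ ≤ Real.exp (2 * M₂ r ‖u‖ - M₁ r ‖u‖) * ‖y - y'‖ := by
        gcongr
        linarith [hA2nonneg r hr ‖u‖]
end
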